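/- With Ω ⊂ ℝ³ the wedge region defined below and δ := arctan(1/α) − arctan(α), the second moments of Ω with respect to Lebesgue measure on ℝ³ satisfy ∫_Ω x² dV = ∫_Ω y² dV = ∫_Ω z² dV = (√3/2)·δ·ρ₀⁵, and the mixed moments vanish: ∫_Ω x·y dV = ∫_Ω x·z dV = ∫_Ω y·z dV = 0. -/

import Mathlib

open MeasureTheory

/-- The wedge region `Ω₊` in `ℝ³` (coordinates `(x,y,z)`): points with
`√(x²+y²) ≤ ρ₀`, `x·y > 0`, `α·|x| ≤ |y| ≤ (1/α)·|x|`, and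
`z ∈ (−(√3/2)·ρ₀, (√3/2)·ρ₀)`. -/
def wedgePlus (α ρ₀ : ℝ) : Set (ℝ × ℝ × ℝ) :=
  {p : ℝ × ℝ × ℝ |
    (Real.sqrt (p.1 ^ 2 + p.2.1 ^ 2) ≤ ρ₀ ∧ 0 < p.1 * p.2.1 ∧
      α * |p.1| ≤ |p.2.1| ∧ |p.2.1| ≤ (1 / α) * |p.1|) ∧
    p.2.2 ∈ Set.Ioo (-(Real.sqrt 3 / 2 * ρ₀)) (Real.sqrt 3 / 2 * ρ₀)}

/-- The wedge region `Ω₋` in `ℝ³`: same as `Ω₊` but with `x·y < 0`. -/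
def wedgeMinus (α ρ₀ : ℝ) : Set (ℝ × ℝ × ℝ) :=
  {p : ℝ × ℝ × ℝ |
    (Real.sqrt (p.1 ^ 2 + p.2.1 ^ 2) ≤ ρ₀ ∧ p.1 * p.2.1 < 0 ∧
      α * |p.1| ≤ |p.2.1| ∧ |p.2.1| ≤ (1 / α) * |p.1|) ∧
    p.2.2 ∈ Set.Ioo (-(Real.sqrt 3 / 2 * ρ₀)) (Real.sqrt 3 / 2 * ρ₀)}

/-- The planar cross-section of the wedge region. -/
def wedgeSection (α ρ₀ : ℝ) : Set (ℝ × ℝ) :=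
  {q : ℝ × ℝ | Real.sqrt (q.1 ^ 2 + q.2 ^ 2) ≤ ρ₀ ∧ q.1 * q.2 ≠ 0 ∧
    α * |q.1| ≤ |q.2| ∧ |q.2| ≤ (1 / α) * |q.1|}

/-- The angles of the rays contained in the planar wedge. -/
def wedgeAngles (α : ℝ) : Set ℝ :=
  {θ : ℝ | Real.cos θ * Real.sin θ ≠ 0 ∧
    α * |Real.cos θ| ≤ |Real.sin θ| ∧ |Real.sin θ| ≤ (1 / α) * |Real.cos θ|}

lemma measurableSet_wedgeSection (α ρ₀ : ℝ) : MeasurableSet (wedgeSection α ρ₀) := by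
  unfold wedgeSection
  measurability

lemma measurableSet_wedgeAngles (α : ℝ) : MeasurableSet (wedgeAngles α) := by
  unfold wedgeAngles
  measurability

lemma wedge_eq_preimage_prod (α ρ₀ : ℝ) :
    wedgePlus α ρ₀ ∪ wedgeMinus α ρ₀ = MeasurableEquiv.prodAssoc.symm ⁻¹'
      (wedgeSection α ρ₀ ×ˢ Set.Ioo (-(Real.sqrt 3 / 2 * ρ₀)) (Real.sqrt 3 / 2 * ρ₀)) := by
  ext ⟨x, y, z⟩
  have h : x * y ≠ 0 ↔ 0 < x * y ∨ x * y < 0 := by rw [ne_iff_lt_or_gt, or_comm]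
  simp only [wedgePlus, wedgeMinus, wedgeSection, Set.mem_union, Set.mem_ofPred_eq,
    Set.mem_preimage, MeasurableEquiv.prodAssoc, MeasurableEquiv.symm_mk, MeasurableEquiv.coe_mk,
    Equiv.prodAssoc_symm_apply, Set.mem_prod, h]
  tauto

lemma integral_wedge_mul (α ρ₀ : ℝ) (f : ℝ × ℝ → ℝ) (g : ℝ → ℝ) :
    ∫ p in wedgePlus α ρ₀ ∪ wedgeMinus α ρ₀, f (p.1, p.2.1) * g p.2.2 =
      (∫ q in wedgeSection α ρ₀, f q) *
        ∫ z in Set.Ioo (-(Real.sqrt 3 / 2 * ρ₀)) (Real.sqrt 3 / 2 * ρ₀), g z := by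
  rw [wedge_eq_preimage_prod, ← setIntegral_prod_mul]
  exact (volume_preserving_prodAssoc.symm _).setIntegral_preimage_emb
    MeasurableEquiv.prodAssoc.symm.measurableEmbedding (fun q : (ℝ × ℝ) × ℝ => f q.1 * g q.2) _

lemma indicator_wedgeAngles_periodic {α : ℝ} (hα : 0 < α) :
    Function.Periodic ((wedgeAngles α).indicator fun _ => (1 : ℝ)) (Real.pi / 2) := by
  intro θ
  have h : θ + Real.pi / 2 ∈ wedgeAngles α ↔ θ ∈ wedgeAngles α := by
    simp only [wedgeAngles, Set.mem_ofPred_eq, Real.cos_add_pi_div_two, Real.sin_add_pi_div_two,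
      abs_neg, one_div, inv_mul_eq_div, le_div_iff₀ hα]
    rw [neg_mul, neg_ne_zero, mul_comm (Real.sin θ), mul_comm α, mul_comm α]
    tauto
  by_cases hθ : θ ∈ wedgeAngles α <;> simp [hθ, h]

lemma mem_wedgeAngles_iff {α θ : ℝ} (hθ : θ ∈ Set.Ioo 0 (Real.pi / 2)) :
    θ ∈ wedgeAngles α ↔ θ ∈ Set.Icc (Real.arctan α) (Real.arctan (1 / α)) := by
  have hc : 0 < Real.cos θ := Real.cos_pos_of_mem_Ioo ⟨by linarith [hθ.1, Real.pi_pos], hθ.2⟩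
  have hs : 0 < Real.sin θ := Real.sin_pos_of_pos_of_lt_pi hθ.1 (by linarith [hθ.1, hθ.2])
  have ht : Real.arctan (Real.tan θ) = θ := Real.arctan_tan (by linarith [hθ.1, Real.pi_pos]) hθ.2
  have h₁ : Real.arctan α ≤ θ ↔ α ≤ Real.tan θ := by
    conv_lhs => rw [← ht]
    exact Real.arctan_le_arctan_iff
  have h₂ : θ ≤ Real.arctan (1 / α) ↔ Real.tan θ ≤ 1 / α := by
    conv_lhs => rw [← ht]
    exact Real.arctan_le_arctan_iff
  rw [Set.mem_Icc, h₁, h₂, Real.tan_eq_sin_div_cos, le_div_iff₀ hc, div_le_iff₀ hc]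
  simp [wedgeAngles, abs_of_pos hc, abs_of_pos hs, hc.ne', hs.ne']

lemma integral_indicator_wedgeAngles {α : ℝ} (hα0 : 0 < α) (hα1 : α < 1) :
    ∫ θ in Set.Ioo (-Real.pi) Real.pi, (wedgeAngles α).indicator (fun _ => (1 : ℝ)) θ =
      4 * (Real.arctan (1 / α) - Real.arctan α) := by
  have hle : Real.arctan α ≤ Real.arctan (1 / α) :=
    Real.arctan_le_arctan_iff.2 (hα1.le.trans (by rw [le_div_iff₀ hα0]; linarith))
  have hsub : Set.Icc (Real.arctan α) (Real.arctan (1 / α)) ⊆ Set.Ioo 0 (Real.pi / 2) :=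
    fun θ hθ => ⟨(Real.arctan_pos.2 hα0).trans_le hθ.1,
      hθ.2.trans_lt (Real.arctan_lt_pi_div_two _)⟩
  have hquad : ∫ θ in (0 : ℝ)..(0 + Real.pi / 2),
      (wedgeAngles α).indicator (fun _ => (1 : ℝ)) θ =
      Real.arctan (1 / α) - Real.arctan α := by
    rw [zero_add, intervalIntegral.integral_of_le Real.pi_div_two_pos.le]
    have hcongr : Set.EqOn ((wedgeAngles α).indicator fun _ => (1 : ℝ))
        ((Set.Icc (Real.arctan α) (Real.arctan (1 / α))).indicator fun _ => (1 : ℝ))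
        (Set.Ioo 0 (Real.pi / 2)) := by
      intro θ hθ
      exact Set.indicator_const_eq_indicator_const (mem_wedgeAngles_iff hθ)
    rw [integral_Ioc_eq_integral_Ioo, setIntegral_congr_fun measurableSet_Ioo hcongr,
      setIntegral_indicator measurableSet_Icc, Set.inter_eq_right.2 hsub]
    simp only [integral_const, smul_eq_mul, mul_one, measureReal_restrict_apply_univ]
    rw [Real.volume_real_Icc_of_le hle]
  have h := (indicator_wedgeAngles_periodic hα0).intervalIntegral_add_zsmul_eq 4 (-Real.pi)
    fun _ _ => intervalIntegrable_const.imp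
      (·.indicator (measurableSet_wedgeAngles α)) (·.indicator (measurableSet_wedgeAngles α))
  rw [(indicator_wedgeAngles_periodic hα0).intervalIntegral_add_eq (-Real.pi) 0, hquad] at h
  rw [← integral_Ioc_eq_integral_Ioo,
    ← intervalIntegral.integral_of_le (by linarith [Real.pi_pos])]
  simp only [zsmul_eq_mul, Int.cast_ofNat] at h
  rwa [show -Real.pi + 4 * (Real.pi / 2) = Real.pi by ring] at h

lemma mem_wedgeSection_polarCoord_symm {α ρ₀ r θ : ℝ} (hr : 0 < r) :
    polarCoord.symm (r, θ) ∈ wedgeSection α ρ₀ ↔ r ≤ ρ₀ ∧ θ ∈ wedgeAngles α := by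
  have hsq : (r * Real.cos θ) ^ 2 + (r * Real.sin θ) ^ 2 = r ^ 2 := by
    linear_combination r ^ 2 * Real.cos_sq_add_sin_sq θ
  have h₁ : α * (r * |Real.cos θ|) = r * (α * |Real.cos θ|) := by ring
  have h₂ : 1 / α * (r * |Real.cos θ|) = r * (1 / α * |Real.cos θ|) := by ring
  simp only [polarCoord_symm_apply, wedgeSection, wedgeAngles, Set.mem_ofPred_eq, hsq,
    Real.sqrt_sq hr.le, abs_mul, abs_of_pos hr, h₁, h₂, mul_le_mul_iff_right₀ hr]
  simp [hr.ne']

/-- The radial moments of the planar wedge. -/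
lemma integral_wedgeSection_radial {α ρ₀ : ℝ} (hα0 : 0 < α) (hα1 : α < 1) (hρ₀ : 0 < ρ₀)
    (n : ℕ) :
    ∫ q in wedgeSection α ρ₀, (q.1 ^ 2 + q.2 ^ 2) ^ n =
      ρ₀ ^ (2 * n + 2) / (2 * n + 2) * (4 * (Real.arctan (1 / α) - Real.arctan α)) := by
  have hr : ∫ r in Set.Ioi (0 : ℝ), (Set.Iic ρ₀).indicator (fun r => r ^ (2 * n + 1)) r =
      ρ₀ ^ (2 * n + 2) / (2 * n + 2) := by
    rw [setIntegral_indicator measurableSet_Iic, Set.Ioi_inter_Iic,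
      ← intervalIntegral.integral_of_le hρ₀.le, integral_pow]
    push_cast
    ring
  rw [← integral_indicator (measurableSet_wedgeSection α ρ₀), ← integral_comp_polarCoord_symm,
    ← hr, ← integral_indicator_wedgeAngles hα0 hα1, ← setIntegral_prod_mul]
  refine setIntegral_congr_fun polarCoord.open_target.measurableSet ?_
  rintro ⟨r, θ⟩ ⟨hr0 : 0 < r, -⟩
  have hsq : (r * Real.cos θ) ^ 2 + (r * Real.sin θ) ^ 2 = r ^ 2 := by
    linear_combination r ^ 2 * Real.cos_sq_add_sin_sq θ
  have hmem := mem_wedgeSection_polarCoord_symm (α := α) (ρ₀ := ρ₀) (θ := θ) hr0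
  by_cases h₁ : r ∈ Set.Iic ρ₀
  · by_cases h₂ : θ ∈ wedgeAngles α
    · simp only [Set.indicator_of_mem (hmem.2 ⟨h₁, h₂⟩), Set.indicator_of_mem h₁,
        Set.indicator_of_mem h₂, smul_eq_mul]
      simp only [polarCoord_symm_apply, hsq]
      ring
    · simp only [Set.indicator_of_notMem fun h => h₂ (hmem.1 h).2, Set.indicator_of_notMem h₂,
        smul_zero, mul_zero]
  · simp only [Set.indicator_of_notMem fun h => h₁ (hmem.1 h).1, Set.indicator_of_notMem h₁,
      smul_zero, zero_mul]

lemma swap_preimage_wedgeSection {α : ℝ} (hα : 0 < α) (ρ₀ : ℝ) :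
    Prod.swap ⁻¹' wedgeSection α ρ₀ = wedgeSection α ρ₀ := by
  ext ⟨x, y⟩
  simp only [wedgeSection, Set.mem_preimage, Set.mem_ofPred_eq, Prod.fst_swap, Prod.snd_swap,
    one_div, inv_mul_eq_div, le_div_iff₀ hα]
  rw [add_comm, mul_comm y, mul_comm α, mul_comm α]
  tauto

lemma integral_wedgeSection_snd_sq {α : ℝ} (hα : 0 < α) (ρ₀ : ℝ) :
    ∫ q in wedgeSection α ρ₀, q.2 ^ 2 = ∫ q in wedgeSection α ρ₀, q.1 ^ 2 := by
  have h := (Measure.measurePreserving_swap (μ := (volume : Measure ℝ))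
    (ν := (volume : Measure ℝ))).setIntegral_preimage_emb
    MeasurableEquiv.prodComm.measurableEmbedding (fun q : ℝ × ℝ => q.1 ^ 2) (wedgeSection α ρ₀)
  rw [swap_preimage_wedgeSection hα] at h
  exact h

lemma integral_wedgeSection_mul (α ρ₀ : ℝ) :
    ∫ q in wedgeSection α ρ₀, q.1 * q.2 = 0 := by
  have hmp : MeasurePreserving (Prod.map Neg.neg id : ℝ × ℝ → ℝ × ℝ) :=
    (Measure.measurePreserving_neg (volume : Measure ℝ)).prod (MeasurePreserving.id volume)
  have h := hmp.setIntegral_preimage_emb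
    ((MeasurableEquiv.neg ℝ).prodCongr (MeasurableEquiv.refl ℝ)).measurableEmbedding
    (fun q : ℝ × ℝ => q.1 * q.2) (wedgeSection α ρ₀)
  have hpre : (Prod.map Neg.neg id : ℝ × ℝ → ℝ × ℝ) ⁻¹' wedgeSection α ρ₀ =
      wedgeSection α ρ₀ := by
    ext ⟨x, y⟩
    simp [wedgeSection]
  rw [hpre] at h
  simp only [Prod.map_fst, Prod.map_snd, id, neg_mul, integral_neg] at h
  linarith

lemma integrableOn_wedgeSection (α ρ₀ : ℝ) {f : ℝ × ℝ → ℝ} (hf : Continuous f) :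
    IntegrableOn f (wedgeSection α ρ₀) := by
  refine (hf.continuousOn.integrableOn_compact
    (isCompact_Icc.prod isCompact_Icc :
      IsCompact (Set.Icc (-ρ₀) ρ₀ ×ˢ Set.Icc (-ρ₀) ρ₀))).mono_set ?_
  rintro ⟨x, y⟩ ⟨h, -⟩
  exact ⟨abs_le.1 ((Real.abs_le_sqrt (by simpa using sq_nonneg y)).trans h),
    abs_le.1 ((Real.abs_le_sqrt (by simpa using sq_nonneg x)).trans h)⟩

lemma integral_wedgeSection_fst_sq {α ρ₀ : ℝ} (hα0 : 0 < α) (hα1 : α < 1) (hρ₀ : 0 < ρ₀) :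
    ∫ q in wedgeSection α ρ₀, q.1 ^ 2 =
      ρ₀ ^ 4 / 2 * (Real.arctan (1 / α) - Real.arctan α) := by
  have h := integral_wedgeSection_radial hα0 hα1 hρ₀ 1
  simp only [pow_one] at h
  rw [integral_add (integrableOn_wedgeSection α ρ₀ (by fun_prop))
    (integrableOn_wedgeSection α ρ₀ (by fun_prop)), integral_wedgeSection_snd_sq hα0] at h
  norm_num at h ⊢
  linarith

lemma integral_Ioo_neg_pow {c : ℝ} (hc : 0 ≤ c) (n : ℕ) :
    ∫ z in Set.Ioo (-c) c, z ^ n = (c ^ (n + 1) - (-c) ^ (n + 1)) / (n + 1) := by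
  rw [← integral_Ioc_eq_integral_Ioo, ← intervalIntegral.integral_of_le (by linarith),
    integral_pow]

/-- Second moments of the wedge region `Ω = Ω₊ ∪ Ω₋` with
respect to Lebesgue measure on `ℝ³`: with `δ = arctan(1/α) − arctan α`,
`∫_Ω x² = ∫_Ω y² = ∫_Ω z² = (√3/2)·δ·ρ₀⁵`, and the mixed moments
`∫_Ω xy = ∫_Ω xz = ∫_Ω yz = 0`. -/
theorem wedge_second_moments (α ρ₀ : ℝ) (hα0 : 0 < α) (hα1 : α < 1)
    (hρ₀ : 0 < ρ₀) :
    (∫ p in wedgePlus α ρ₀ ∪ wedgeMinus α ρ₀, p.1 ^ 2) =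
        Real.sqrt 3 / 2 * (Real.arctan (1 / α) - Real.arctan α) * ρ₀ ^ 5 ∧
    (∫ p in wedgePlus α ρ₀ ∪ wedgeMinus α ρ₀, p.2.1 ^ 2) =
        Real.sqrt 3 / 2 * (Real.arctan (1 / α) - Real.arctan α) * ρ₀ ^ 5 ∧
    (∫ p in wedgePlus α ρ₀ ∪ wedgeMinus α ρ₀, p.2.2 ^ 2) =
        Real.sqrt 3 / 2 * (Real.arctan (1 / α) - Real.arctan α) * ρ₀ ^ 5 ∧
    (∫ p in wedgePlus α ρ₀ ∪ wedgeMinus α ρ₀, p.1 * p.2.1) = 0 ∧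
    (∫ p in wedgePlus α ρ₀ ∪ wedgeMinus α ρ₀, p.1 * p.2.2) = 0 ∧
    (∫ p in wedgePlus α ρ₀ ∪ wedgeMinus α ρ₀, p.2.1 * p.2.2) = 0 := by
  have hc : 0 ≤ Real.sqrt 3 / 2 * ρ₀ := by positivity
  have h3 : Real.sqrt 3 ^ 3 = 3 * Real.sqrt 3 := by
    rw [pow_succ, Real.sq_sqrt (by norm_num)]
  have hz₀ := integral_Ioo_neg_pow hc 0
  have hz₁ := integral_Ioo_neg_pow hc 1
  have hz₂ := integral_Ioo_neg_pow hc 2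
  have harea := integral_wedgeSection_radial hα0 hα1 hρ₀ 0
  simp only [pow_zero, pow_one] at hz₀ hz₁ harea
  have hx := integral_wedgeSection_fst_sq hα0 hα1 hρ₀
  refine ⟨?_, ?_, ?_, ?_, ?_, ?_⟩
  · have h := integral_wedge_mul α ρ₀ (fun q => q.1 ^ 2) (fun _ => 1)
    simp only [mul_one] at h
    rw [h, hx, hz₀]
    norm_num
    ring
  · have h := integral_wedge_mul α ρ₀ (fun q => q.2 ^ 2) (fun _ => 1)
    simp only [mul_one] at h
    rw [h, integral_wedgeSection_snd_sq hα0, hx, hz₀]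
    norm_num
    ring
  · have h := integral_wedge_mul α ρ₀ (fun _ => 1) (fun z => z ^ 2)
    simp only [one_mul] at h
    rw [h, harea, hz₂]
    norm_num
    linear_combination (ρ₀ ^ 5 * (Real.arctan α⁻¹ - Real.arctan α) / 6) * h3
  · have h := integral_wedge_mul α ρ₀ (fun q => q.1 * q.2) (fun _ => 1)
    simp only [mul_one] at h
    rw [h, integral_wedgeSection_mul, zero_mul]
  · rw [integral_wedge_mul α ρ₀ (fun q => q.1) (fun z => z), hz₁]
    simp
  · rw [integral_wedge_mul α ρ₀ (fun q => q.2) (fun z => z), hz₁]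
    simp
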